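/- Let A be the free abelian group ℤ²⁷ with basis e₀; p₁,…,p₆; t₁,…,t₆; s₁,…,s₆; a₁,…,a₄; b₁,…,b₄, and let R ⊆ A be the subgroup generated by the 19 elements p_i − 2t_i, p_i − 3s_i, e₀ − p_i + t_i + s_i (for 1 ≤ i ≤ 6) and 42e₀ − (p₁ + ⋯ + p₆). Then the quotient A/R is isomorphic to ℤ⁸ ⊕ ℤ/6ℤ. -/

import Mathlib

/-- Index type for the 27 generators: `e₀`; `pᵢ, tᵢ, sᵢ` for `1 ≤ i ≤ 6` (encoded as
`(i, 0), (i, 1), (i, 2)`); and `aⱼ, bⱼ` for `1 ≤ j ≤ 4` (encoded as `(false, j), (true, j)`). -/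
abbrev HomologyIndex : Type := Unit ⊕ (Fin 6 × Fin 3) ⊕ (Bool × Fin 4)

/-- `e₀`. -/
def e0 : HomologyIndex → ℤ := Pi.single (Sum.inl ()) 1

/-- `pᵢ`. -/
def pGen (i : Fin 6) : HomologyIndex → ℤ := Pi.single (Sum.inr (Sum.inl (i, 0))) 1

/-- `tᵢ`. -/
def tGen (i : Fin 6) : HomologyIndex → ℤ := Pi.single (Sum.inr (Sum.inl (i, 1))) 1

/-- `sᵢ`. -/
def sGen (i : Fin 6) : HomologyIndex → ℤ := Pi.single (Sum.inr (Sum.inl (i, 2))) 1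

/-- The subgroup of relations, generated by the 19 elements `pᵢ − 2tᵢ`, `pᵢ − 3sᵢ`,
`e₀ − pᵢ + tᵢ + sᵢ` (for `1 ≤ i ≤ 6`) and `42e₀ − (p₁ + ⋯ + p₆)`. -/
def relationSubgroup : Submodule ℤ (HomologyIndex → ℤ) :=
  Submodule.span ℤ
    ((Set.range fun i : Fin 6 => pGen i - 2 • tGen i) ∪
     (Set.range fun i : Fin 6 => pGen i - 3 • sGen i) ∪
     (Set.range fun i : Fin 6 => e0 - pGen i + tGen i + sGen i) ∪
     {(42 : ℤ) • e0 - ∑ i : Fin 6, pGen i})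

theorem sub_two_mem (i : Fin 6) : pGen i - 2 • tGen i ∈ relationSubgroup :=
  Submodule.subset_span (.inl (.inl (.inl ⟨i, rfl⟩)))

theorem sub_three_mem (i : Fin 6) : pGen i - 3 • sGen i ∈ relationSubgroup :=
  Submodule.subset_span (.inl (.inl (.inr ⟨i, rfl⟩)))

theorem e0_sub_mem (i : Fin 6) : e0 - pGen i + tGen i + sGen i ∈ relationSubgroup :=
  Submodule.subset_span (.inl (.inr ⟨i, rfl⟩))

theorem central_mem : (42 : ℤ) • e0 - ∑ i : Fin 6, pGen i ∈ relationSubgroup :=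
  Submodule.subset_span (.inr rfl)

/-- The relations at the `i`-th singular branch, combined with integer coefficients. -/
theorem combination_mem (i : Fin 6) (x y z : ℤ) :
    x • (pGen i - 2 • tGen i) + y • (pGen i - 3 • sGen i) +
      z • (e0 - pGen i + tGen i + sGen i) ∈ relationSubgroup :=
  add_mem (add_mem (Submodule.smul_mem _ x (sub_two_mem i))
    (Submodule.smul_mem _ y (sub_three_mem i))) (Submodule.smul_mem _ z (e0_sub_mem i))

theorem pGen_sub_mem (i : Fin 6) : pGen i - (6 : ℤ) • e0 ∈ relationSubgroup := by
  convert combination_mem i (-3) (-2) (-6) using 1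
  module

theorem tGen_sub_mem (i : Fin 6) : tGen i - (3 : ℤ) • e0 ∈ relationSubgroup := by
  convert combination_mem i (-2) (-1) (-3) using 1
  module

theorem sGen_sub_mem (i : Fin 6) : sGen i - (2 : ℤ) • e0 ∈ relationSubgroup := by
  convert combination_mem i (-1) (-1) (-2) using 1
  module

theorem six_smul_e0_mem : (6 : ℤ) • e0 ∈ relationSubgroup := by
  convert add_mem central_mem (sum_mem fun i (_ : i ∈ Finset.univ) => pGen_sub_mem i) using 1
  rw [Finset.sum_sub_distrib, Finset.sum_const, Finset.card_univ, Fintype.card_fin]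
  module

/-- The functional sending `e₀, pᵢ, tᵢ, sᵢ` to `1, 6, 3, 2` and `aⱼ, bⱼ` to `0`. -/
def torsionWeight : (HomologyIndex → ℤ) →ₗ[ℤ] ℤ :=
  LinearMap.proj (Sum.inl ()) + ∑ i : Fin 6,
    ((6 : ℤ) • LinearMap.proj (Sum.inr (Sum.inl (i, 0))) +
      (3 : ℤ) • LinearMap.proj (Sum.inr (Sum.inl (i, 1))) +
      (2 : ℤ) • LinearMap.proj (Sum.inr (Sum.inl (i, 2))))

theorem torsionWeight_apply (v : HomologyIndex → ℤ) :
    torsionWeight v = v (Sum.inl ()) + ∑ i : Fin 6, (6 * v (Sum.inr (Sum.inl (i, 0))) +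
      3 * v (Sum.inr (Sum.inl (i, 1))) + 2 * v (Sum.inr (Sum.inl (i, 2)))) := by
  simp [torsionWeight]

theorem torsionWeight_e0 : torsionWeight e0 = 1 := by
  simp [torsionWeight_apply, e0]

theorem torsionWeight_pGen (i : Fin 6) : torsionWeight (pGen i) = 6 := by
  simp [torsionWeight_apply, pGen, Pi.single_apply]

theorem torsionWeight_tGen (i : Fin 6) : torsionWeight (tGen i) = 3 := by
  simp [torsionWeight_apply, tGen, Pi.single_apply]

theorem torsionWeight_sGen (i : Fin 6) : torsionWeight (sGen i) = 2 := by
  simp [torsionWeight_apply, sGen, Pi.single_apply]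

/-- A vector without `aⱼ, bⱼ` components is congruent to its weight times `e₀`. -/
theorem sub_torsionWeight_smul_mem {v : HomologyIndex → ℤ} (hv : ∀ j, v (Sum.inr (Sum.inr j)) = 0) :
    v - torsionWeight v • e0 ∈ relationSubgroup := by
  have key : v - torsionWeight v • e0 = ∑ i : Fin 6,
      (v (Sum.inr (Sum.inl (i, 0))) • (pGen i - (6 : ℤ) • e0) +
        v (Sum.inr (Sum.inl (i, 1))) • (tGen i - (3 : ℤ) • e0) +
        v (Sum.inr (Sum.inl (i, 2))) • (sGen i - (2 : ℤ) • e0)) := by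
    ext k
    rw [Finset.sum_apply]
    rcases k with _ | ⟨i, c⟩ | j
    · simp only [torsionWeight_apply, e0, pGen, tGen, sGen, Pi.sub_apply, Pi.add_apply,
        Pi.smul_apply, smul_eq_mul, Pi.single_apply]
      simp [Finset.sum_add_distrib, mul_comm]
      ring
    · fin_cases c <;> simp [e0, pGen, tGen, sGen, Pi.single_apply]
    · simp [e0, pGen, tGen, sGen, hv]
  rw [key]
  exact sum_mem fun i _ => add_mem (add_mem (Submodule.smul_mem _ _ (pGen_sub_mem i))
    (Submodule.smul_mem _ _ (tGen_sub_mem i))) (Submodule.smul_mem _ _ (sGen_sub_mem i))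

/-- The `aⱼ, bⱼ` coordinates together with the weight modulo `6`. -/
def homologyMap : (HomologyIndex → ℤ) →ₗ[ℤ] (Bool × Fin 4 → ℤ) × ZMod 6 :=
  (LinearMap.funLeft ℤ ℤ fun j => Sum.inr (Sum.inr j)).prod
    ((Int.castAddHom (ZMod 6)).toIntLinearMap ∘ₗ torsionWeight)

theorem homologyMap_apply (v : HomologyIndex → ℤ) :
    homologyMap v = (fun j => v (Sum.inr (Sum.inr j)), (torsionWeight v : ZMod 6)) := rfl

theorem homologyMap_surjective : Function.Surjective homologyMap := by
  rintro ⟨w, c⟩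
  obtain ⟨n, rfl⟩ := ZMod.intCast_surjective c
  refine ⟨Sum.elim (fun _ => n) (Sum.elim 0 w), ?_⟩
  simp [homologyMap_apply, torsionWeight_apply]

theorem ker_homologyMap : LinearMap.ker homologyMap = relationSubgroup := by
  apply le_antisymm
  · intro v hv
    rw [LinearMap.mem_ker, homologyMap_apply, Prod.mk_eq_zero] at hv
    obtain ⟨k, hk⟩ := (ZMod.intCast_zmod_eq_zero_iff_dvd _ 6).mp hv.2
    have h := add_mem (sub_torsionWeight_smul_mem (congrFun hv.1))
      (Submodule.smul_mem _ k six_smul_e0_mem)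
    rwa [smul_smul, hk, mul_comm k, Nat.cast_ofNat, sub_add_cancel] at h
  · refine Submodule.span_le.mpr ?_
    rintro _ (((⟨i, rfl⟩ | ⟨i, rfl⟩) | ⟨i, rfl⟩) | rfl) <;>
      rw [SetLike.mem_coe, LinearMap.mem_ker, homologyMap_apply, Prod.mk_eq_zero] <;>
      refine ⟨by ext j; simp [e0, pGen, tGen, sGen], ?_⟩ <;>
      simp only [map_sub, map_add, map_smul, map_nsmul, map_sum, torsionWeight_e0,
        torsionWeight_pGen, torsionWeight_tGen, torsionWeight_sGen]
    · simp
    · simp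
    · simp
    · simp; decide

/-- The quotient of the free abelian group `ℤ²⁷` by the 19 relations is `ℤ⁸ ⊕ ℤ/6ℤ`. -/
theorem homology_of_link_presentation :
    Nonempty (((HomologyIndex → ℤ) ⧸ relationSubgroup) ≃+ ((Fin 8 → ℤ) × ZMod 6)) := by
  rw [← ker_homologyMap]
  let reindex : (Bool × Fin 4 → ℤ) ≃ₗ[ℤ] (Fin 8 → ℤ) :=
    LinearEquiv.funCongrLeft ℤ ℤ (Fintype.equivFinOfCardEq (by simp)).symm
  exact ⟨((homologyMap.quotKerEquivOfSurjective homologyMap_surjective).trans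
    (reindex.prodCongr (LinearEquiv.refl ℤ (ZMod 6)))).toAddEquiv⟩
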